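/- Let ω = exp(πi/3) ∈ ℂ. Then ω⁻²·3 − ω⁻¹ + 1 − ω + ω² = −2 − √3·i, and for every natural number d and every ε ∈ {1, −1} ⊆ ℂ, −2 − √3·i ≠ ε·i·(i·√3)^d. -/

import Mathlib

/-- For `ω = exp(πi/3)`, `ω⁻²·3 − ω⁻¹ + 1 − ω + ω² = −2 − √3·i`, and this
value is not of the Lickorish–Millett form `ε·i·(i√3)^d`. -/
theorem stmt_4 (ω : ℂ) (hω : ω = Complex.exp (Real.pi * Complex.I / 3)) :
    ω ^ (-2 : ℤ) * 3 - ω⁻¹ + 1 - ω + ω ^ 2 =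
      -2 - (Real.sqrt 3 : ℂ) * Complex.I ∧
    ∀ (d : ℕ) (ε : ℂ), ε ∈ ({1, -1} : Set ℂ) →
      (-2 - (Real.sqrt 3 : ℂ) * Complex.I) ≠
        ε * Complex.I * (Complex.I * (Real.sqrt 3 : ℂ)) ^ d := by
  have hs : (Real.sqrt 3 : ℂ) ^ 2 = 3 := by
    rw [← Complex.ofReal_pow, Real.sq_sqrt (by norm_num)]; norm_num
  have hI : Complex.I ^ 2 = -1 := Complex.I_sq
  have hw : ω = 1 / 2 + (Real.sqrt 3 : ℂ) / 2 * Complex.I := by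
    have h : (Real.pi * Complex.I / 3 : ℂ) = ((Real.pi / 3 : ℝ) : ℂ) * Complex.I := by
      push_cast; ring
    rw [hω, h, Complex.exp_mul_I, ← Complex.ofReal_cos, ← Complex.ofReal_sin,
      Real.cos_pi_div_three, Real.sin_pi_div_three]
    push_cast; ring
  have hinv : ω⁻¹ = 1 / 2 - (Real.sqrt 3 : ℂ) / 2 * Complex.I := by
    apply inv_eq_of_mul_eq_one_right
    rw [hw]
    linear_combination (1 / 4 : ℂ) * hs - (Real.sqrt 3 : ℂ) ^ 2 / 4 * hI
  constructor
  · have h2 : ω ^ (-2 : ℤ) = (ω⁻¹) ^ 2 := by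
      rw [zpow_neg, inv_pow]; rfl
    rw [h2, hinv, hw]
    linear_combination (-1 : ℂ) * hs + (Real.sqrt 3 : ℂ) ^ 2 * hI
  · intro d ε hε h
    have hn := congrArg Complex.normSq h
    have h1 : Complex.normSq ε = 1 := by
      rcases hε with rfl | hε
      · simp
      · rw [Set.mem_singleton_iff] at hε
        simp [hε]
    have h7 : Complex.normSq (-2 - (Real.sqrt 3 : ℂ) * Complex.I) = 7 := by
      rw [Complex.normSq_apply]
      simp
      norm_num
    rw [h7, map_mul, map_mul, map_pow, map_mul, h1, Complex.normSq_I,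
      Complex.normSq_ofReal, Real.mul_self_sqrt (by norm_num)] at hn
    have hd : (7 : ℕ) = 3 ^ d := by
      have : (7 : ℝ) = 3 ^ d := by simpa using hn
      exact_mod_cast this
    rcases d with _ | d
    · simp at hd
    · rw [pow_succ] at hd
      omega
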